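/- Let d ≥ 3, f ∈ 𝒮(ℝ^d; ℂ), ξ₀ ∈ ℝ^d \ {0}. For h > 0, let ξ^(h) ∈ C¹([0,∞); ℝ^d) be the unique global solution of (d/dt) ξ^(h) = 𝓕^(h)(ξ^(h)), ξ^(h)(0) = ξ₀, and let ξ^(0) ∈ C¹([0, T_max); ℝ^d) be the unique maximal solution of (d/dt) ξ^(0) = F^(0)(ξ^(0)), ξ^(0)(0) = ξ₀. Then for every T ∈ (0, T_max), sup_{t ∈ [0,T]} |ξ^(h)(t) − ξ^(0)(t)| → 0 as h → 0. -/

import Mathlib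

open MeasureTheory Filter Set
open scoped RealInnerProductSpace Topology ENNReal

noncomputable section

abbrev E (d : ℕ) := EuclideanSpace ℝ (Fin d)

/-- `g(η) = η |f(η)|²`. -/
def gfun {d : ℕ} (f : SchwartzMap (E d) ℂ) (η : E d) : E d := ‖f η‖ ^ 2 • η

/-- the average `⨍_a^b u(σ) dσ`. -/
def intAvg {d : ℕ} (u : ℝ → E d) (a b : ℝ) : E d := (b - a)⁻¹ • ∫ σ in a..b, u σ

/-- `𝓕^(h)(u)(t)`; since `g` is real-valued, taking the real part of the complex
integral amounts to replacing `e^{-irθ}` by `cos (rθ)`. -/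
def calF {d : ℕ} (f : SchwartzMap (E d) ℂ) (h : ℝ) (u : ℝ → E d) (t : ℝ) : E d :=
  (-2 : ℝ) • ∫ η, (∫ r in (0:ℝ)..(t / h),
    Real.cos (r * (‖η‖ ^ 2 - 2 * ⟪η, intAvg u (t - h * r) t⟫))) • gfun f η

/-- the `i`-th component of the Fourier transform `ĝ(x) = (2π)^{-d/2} ∫ e^{-ix·η} g(η) dη`. -/
def ftGi {d : ℕ} (f : SchwartzMap (E d) ℂ) (i : Fin d) (x : E d) : ℂ :=
  ((2 * Real.pi) ^ (-(d : ℝ) / 2) : ℝ) *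
    ∫ η, Complex.exp (-Complex.I * (⟪x, η⟫ : ℝ)) * ((gfun f η i : ℝ) : ℂ)

/-- `‖g‖_{L¹}`. -/
def L1g {d : ℕ} (f : SchwartzMap (E d) ℂ) : ℝ := ∫ η, ‖gfun f η‖

/-- `‖ĝ‖_{L¹}` (with the euclidean norm of the complex vector `ĝ(x)`). -/
def L1ftg {d : ℕ} (f : SchwartzMap (E d) ℂ) : ℝ :=
  ∫ x, Real.sqrt (∑ i, ‖ftGi f i x‖ ^ 2)

/-- `C_g^1 = ‖g‖_{L¹} + (d/2 − 1) π^{d/2} ‖ĝ‖_{L¹}`. -/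
def Cg1 {d : ℕ} (f : SchwartzMap (E d) ℂ) : ℝ :=
  L1g f + ((d : ℝ) / 2 - 1) * Real.pi ^ ((d : ℝ) / 2) * L1ftg f

/-- the inner integral `∫_{ℝ^d} e^{-ir(|η|²-2η·u)} g(η) dη` (the real part being taken
componentwise, `e^{-irθ}` contributes `cos (rθ)` since `g` is real). -/
def F0inner {d : ℕ} (f : SchwartzMap (E d) ℂ) (r : ℝ) (u : E d) : E d :=
  ∫ η, Real.cos (r * (‖η‖ ^ 2 - 2 * ⟪η, u⟫)) • gfun f η

/-- `F^(0)(u) = −2 Re ∫_0^∞ (∫ e^{−ir(|η|²−2η·u)} η |f(η)|² dη) dr`, as the improper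
integral in `r` (i.e. the limit of the integrals over `[0,R]` as `R → ∞`). -/
def F0pt {d : ℕ} (f : SchwartzMap (E d) ℂ) (u : E d) : E d :=
  limUnder atTop fun R : ℝ => ∫ r in (0:ℝ)..R, (-2 : ℝ) • F0inner f r u

section PhaseIntegrals

open Complex (I)
open scoped FourierTransform

variable {d : ℕ} {V : Type*} [NormedAddCommGroup V] [NormedSpace ℂ V]

lemma norm_cexp_mul_I_sub_le (a b : ℝ) :
    ‖Complex.exp (a * I) - Complex.exp (b * I)‖ ≤ |a - b| := by
  have h : Complex.exp (a * I) - Complex.exp (b * I)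
      = Complex.exp (b * I) * (Complex.exp (I * (a - b : ℝ)) - 1) := by
    rw [mul_sub, ← Complex.exp_add, mul_one]
    congr 2
    push_cast
    ring
  rw [h, norm_mul, Complex.norm_exp_ofReal_mul_I, one_mul]
  exact Real.norm_exp_I_mul_ofReal_sub_one_le

lemma integrable_phase_smul (φ : SchwartzMap (E d) V) {a : E d → ℝ} (ha : Continuous a) :
    Integrable fun η => Complex.exp (a η * I) • φ η := by
  refine φ.integrable.mono (Continuous.aestronglyMeasurable ?_) (Eventually.of_forall fun η => ?_)
  · exact (by fun_prop : Continuous fun η => Complex.exp (a η * I)).smul φ.continuous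
  · rw [norm_smul, Complex.norm_exp_ofReal_mul_I, one_mul]

lemma norm_integral_phase_smul_le (φ : SchwartzMap (E d) V) (a : E d → ℝ) :
    ‖∫ η, Complex.exp (a η * I) • φ η‖ ≤ ∫ η, ‖φ η‖ := by
  refine (norm_integral_le_integral_norm _).trans_eq (integral_congr_ae ?_)
  refine Eventually.of_forall fun η => ?_
  simp only [norm_smul, Complex.norm_exp_ofReal_mul_I, one_mul]

lemma norm_integral_phase_sub_le (φ : SchwartzMap (E d) V) {a b : E d → ℝ} (ha : Continuous a)
    (hb : Continuous b) {c₁ c₂ : ℝ} (h : ∀ η, |a η - b η| ≤ c₁ * ‖η‖ + c₂ * ‖η‖ ^ 2) :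
    ‖(∫ η, Complex.exp (a η * I) • φ η) - ∫ η, Complex.exp (b η * I) • φ η‖
      ≤ c₁ * (∫ η, ‖η‖ * ‖φ η‖) + c₂ * ∫ η, ‖η‖ ^ 2 * ‖φ η‖ := by
  have h1 : Integrable fun η => ‖η‖ * ‖φ η‖ := by simpa using φ.integrable_pow_mul volume 1
  have h2 := φ.integrable_pow_mul volume 2
  rw [← integral_sub (integrable_phase_smul φ ha) (integrable_phase_smul φ hb),
    ← integral_const_mul, ← integral_const_mul,
    ← integral_add (h1.const_mul _) (h2.const_mul _)]
  refine norm_integral_le_of_norm_le ((h1.const_mul _).add (h2.const_mul _))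
    (Eventually.of_forall fun η => ?_)
  rw [← sub_smul, norm_smul]
  calc _ ≤ (c₁ * ‖η‖ + c₂ * ‖η‖ ^ 2) * ‖φ η‖ := by
        gcongr
        exact (norm_cexp_mul_I_sub_le _ _).trans (h η)
    _ = _ := by ring

/-- The oscillatory integral `∫ e^{-ir(|η|² - 2η·u)} φ(η) dη`. -/
def oscInt (φ : SchwartzMap (E d) V) (r : ℝ) (u : E d) : V :=
  ∫ η, Complex.exp ((-(r * (‖η‖ ^ 2 - 2 * ⟪η, u⟫)) : ℝ) * I) • φ η

/-- The integral `∫ e^{i(π² s |w|² - 2π u·w)} ψ(w) dw` on the Fourier side. -/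
def dualInt (ψ : SchwartzMap (E d) V) (s : ℝ) (u : E d) : V :=
  ∫ w, Complex.exp ((Real.pi ^ 2 * s * ‖w‖ ^ 2 - 2 * Real.pi * ⟪u, w⟫ : ℝ) * I) • ψ w

lemma integral_gaussian_smul_eq [CompleteSpace V] (φ : SchwartzMap (E d) V) {b : ℂ}
    (hb : 0 < b.re) (x : E d) :
    ∫ η, Complex.exp (-b * ‖η‖ ^ 2 + 2 * Real.pi * I * ⟪x, η⟫) • φ η
      = (Real.pi / b) ^ (d / 2 : ℂ) •
        ∫ w, Complex.exp (-Real.pi ^ 2 * ‖x - w‖ ^ 2 / b) • (𝓕⁻ φ : SchwartzMap (E d) V) w := by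
  have J : Integrable fun v : E d =>
      Complex.exp (-b * ‖v‖ ^ 2 + 2 * Real.pi * I * ⟪x, v⟫) :=
    GaussianFourier.integrable_cexp_neg_mul_sq_norm_add hb _ _
  have key := VectorFourier.integral_fourierIntegral_smul_eq_flip (L := innerₗ (E d))
      Real.continuous_fourierChar continuous_inner J
      ((𝓕⁻ φ : SchwartzMap (E d) V).integrable (μ := volume))
  have h1 : ∀ v, VectorFourier.fourierIntegral Real.fourierChar volume (innerₗ (E d)).flip
      (𝓕⁻ φ : SchwartzMap (E d) V) v = φ v := by
    intro v
    have h2 : (𝓕 (𝓕⁻ φ) : SchwartzMap (E d) V) v = φ v := by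
      rw [FourierTransform.fourier_fourierInv_eq]
    rw [← h2, SchwartzMap.fourier_coe, flip_innerₗ]
    rfl
  refine (integral_congr_ae (Eventually.of_forall fun v => congrArg (Complex.exp
    (-b * ‖v‖ ^ 2 + 2 * Real.pi * I * ⟪x, v⟫) • ·) (h1 v).symm)).trans (key.symm.trans ?_)
  rw [← integral_smul]
  congr 1
  ext1 w
  rw [smul_smul]
  congr 1
  have := fourier_gaussian_innerProductSpace' hb x w
  rw [finrank_euclideanSpace_fin] at this
  exact this

lemma oscInt_eq [CompleteSpace V] (φ : SchwartzMap (E d) V) {r : ℝ} (hr : 0 < r) (u : E d) :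
    oscInt φ r u = (Real.pi / (r * I)) ^ (d / 2 : ℂ) •
      Complex.exp ((r * ‖u‖ ^ 2 : ℝ) * I) • dualInt (𝓕⁻ φ) r⁻¹ u := by
  have hb : Tendsto (fun ε : ℝ => (ε : ℂ) + r * I) (𝓝[>] 0) (𝓝 (r * I)) := by
    have : Tendsto (fun ε : ℝ => (ε : ℂ) + r * I) (𝓝 0) (𝓝 (((0 : ℝ) : ℂ) + r * I)) :=
      (by fun_prop : Continuous fun ε : ℝ => (ε : ℂ) + r * I).tendsto 0
    simpa using this.mono_left nhdsWithin_le_nhds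
  have hrI : (r : ℂ) * I ≠ 0 := mul_ne_zero (by exact_mod_cast hr.ne') Complex.I_ne_zero
  have hpos : ∀ᶠ ε : ℝ in 𝓝[>] 0, 0 < ε := eventually_mem_nhdsWithin
  have hleft : Tendsto (fun ε : ℝ => ∫ η, Complex.exp (-((ε : ℂ) + r * I) * ‖η‖ ^ 2
      + 2 * Real.pi * I * ⟪(r / Real.pi) • u, η⟫) • φ η) (𝓝[>] 0) (𝓝 (oscInt φ r u)) := by
    refine tendsto_integral_filter_of_dominated_convergence (fun η => ‖φ η‖) ?_ ?_
      (φ.integrable (μ := volume)).norm ?_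
    · refine Eventually.of_forall fun ε => Continuous.aestronglyMeasurable ?_
      exact (by fun_prop : Continuous fun η : E d => Complex.exp (-((ε : ℂ) + r * I) * ‖η‖ ^ 2
      + 2 * Real.pi * I * ⟪(r / Real.pi) • u, η⟫)).smul φ.continuous
    · filter_upwards [hpos] with ε hε
      refine Eventually.of_forall fun η => ?_
      rw [norm_smul, Complex.norm_exp]
      refine mul_le_of_le_one_left (norm_nonneg _) (Real.exp_le_one_iff.2 ?_)
      have : (-((ε : ℂ) + r * I) * ‖η‖ ^ 2
          + 2 * Real.pi * I * ⟪(r / Real.pi) • u, η⟫).re = - (ε * ‖η‖ ^ 2) := by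
        rw [← Complex.ofReal_pow]
        simp [-Complex.ofReal_pow]
      rw [this]
      have := mul_nonneg hε.le (sq_nonneg ‖η‖)
      linarith
    · refine Eventually.of_forall fun η => Tendsto.smul_const ?_ _
      refine (Complex.continuous_exp.tendsto _).comp ?_
      have := ((hb.neg).mul_const ((‖η‖ : ℂ) ^ 2)).add_const
        (2 * Real.pi * I * ⟪(r / Real.pi) • u, η⟫)
      convert this using 2
      rw [real_inner_smul_left, real_inner_comm]
      have hpi : (Real.pi : ℂ) ≠ 0 := by exact_mod_cast Real.pi_ne_zero
      push_cast
      field_simp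
      ring
  have hright : Tendsto (fun ε : ℝ => (Real.pi / ((ε : ℂ) + r * I)) ^ (d / 2 : ℂ) •
        ∫ w, Complex.exp (-Real.pi ^ 2 * ‖(r / Real.pi) • u - w‖ ^ 2 / ((ε : ℂ) + r * I)) •
          (𝓕⁻ φ : SchwartzMap (E d) V) w) (𝓝[>] 0) (𝓝 ((Real.pi / (r * I)) ^ (d / 2 : ℂ) •
      Complex.exp ((r * ‖u‖ ^ 2 : ℝ) * I) • dualInt (𝓕⁻ φ) r⁻¹ u)) := by
    refine Tendsto.smul ?_ ?_
    · refine Tendsto.cpow (tendsto_const_nhds.div hb hrI) tendsto_const_nhds ?_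
      right
      have : (Real.pi : ℂ) / (r * I) = -((Real.pi / r : ℝ) : ℂ) * I := by
        push_cast
        rw [div_mul_eq_div_div, Complex.div_I]
        ring
      rw [this]
      simp [Real.pi_ne_zero, hr.ne']
    · rw [dualInt, ← integral_smul]
      refine tendsto_integral_filter_of_dominated_convergence
        (fun η => ‖(𝓕⁻ φ : SchwartzMap (E d) V) η‖) ?_ ?_
        (𝓕⁻ φ : SchwartzMap (E d) V).integrable.norm ?_
      · refine Eventually.of_forall fun ε => Continuous.aestronglyMeasurable ?_
        refine Continuous.smul ?_ (𝓕⁻ φ : SchwartzMap (E d) V).continuous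
        fun_prop
      · filter_upwards [hpos] with ε hε
        refine Eventually.of_forall fun η => ?_
        rw [norm_smul, Complex.norm_exp]
        refine mul_le_of_le_one_left (norm_nonneg _) (Real.exp_le_one_iff.2 ?_)
        have : (-(Real.pi : ℂ) ^ 2 * ‖(r / Real.pi) • u - η‖ ^ 2 / ((ε : ℂ) + r * I))
            = ((-(Real.pi ^ 2 * ‖(r / Real.pi) • u - η‖ ^ 2) : ℝ) : ℂ)
              * ((ε : ℂ) + r * I)⁻¹ := by
          push_cast
          ring
        rw [this, Complex.re_ofReal_mul, Complex.inv_re]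
        have : 0 ≤ ((ε : ℂ) + r * I).re := by simpa using hε.le
        have h2 := div_nonneg this (Complex.normSq_nonneg ((ε : ℂ) + r * I))
        nlinarith [mul_nonneg (by positivity :
          0 ≤ Real.pi ^ 2 * ‖(r / Real.pi) • u - η‖ ^ 2) h2]
      · refine Eventually.of_forall fun η => ?_
        rw [smul_smul, ← Complex.exp_add]
        refine Tendsto.smul_const ?_ _
        refine (Complex.continuous_exp.tendsto _).comp ?_
        have := (tendsto_const_nhds (x := -(Real.pi : ℂ) ^ 2
          * ‖(r / Real.pi) • u - η‖ ^ 2)).div hb hrI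
        refine (this.congr fun _ => rfl).trans_eq ?_
        congr 1
        have hn : ‖(r / Real.pi) • u - η‖ ^ 2
            = (r / Real.pi) ^ 2 * ‖u‖ ^ 2 - 2 * (r / Real.pi) * ⟪u, η⟫ + ‖η‖ ^ 2 := by
          rw [norm_sub_sq_real, real_inner_smul_left, norm_smul, mul_pow, Real.norm_eq_abs,
            sq_abs]
          ring
        rw [← Complex.ofReal_pow ‖(r / Real.pi) • u - η‖, hn]
        have hpi : (Real.pi : ℂ) ≠ 0 := by exact_mod_cast Real.pi_ne_zero
        have hr' : (r : ℂ) ≠ 0 := by exact_mod_cast hr.ne'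
        push_cast
        rw [div_mul_eq_div_div, Complex.div_I]
        field_simp
        ring
  refine tendsto_nhds_unique hleft (hright.congr' ?_)
  filter_upwards [hpos] with ε hε
  exact (integral_gaussian_smul_eq φ (by simpa using hε) _).symm

lemma continuous_oscInt (φ : SchwartzMap (E d) V) :
    Continuous fun p : ℝ × E d => oscInt φ p.1 p.2 := by
  refine continuous_of_dominated (bound := fun η => ‖φ η‖) (fun p => ?_) (fun p => ?_)
    (φ.integrable (μ := volume)).norm ?_
  · exact (integrable_phase_smul φ (by fun_prop)).aestronglyMeasurable
  · refine Eventually.of_forall fun η => ?_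
    rw [norm_smul, Complex.norm_exp_ofReal_mul_I, one_mul]
  · exact Eventually.of_forall fun η => by fun_prop

lemma norm_oscInt_le (φ : SchwartzMap (E d) V) (r : ℝ) (u : E d) :
    ‖oscInt φ r u‖ ≤ ∫ η, ‖φ η‖ :=
  norm_integral_phase_smul_le φ _

lemma norm_oscInt_sub_le (φ : SchwartzMap (E d) V) (r s : ℝ) (u v : E d) :
    ‖oscInt φ r u - oscInt φ s v‖
      ≤ 2 * ‖r • u - s • v‖ * (∫ η, ‖η‖ * ‖φ η‖) + |r - s| * ∫ η, ‖η‖ ^ 2 * ‖φ η‖ := by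
  refine norm_integral_phase_sub_le φ (by fun_prop) (by fun_prop) fun η => ?_
  have h : -(r * (‖η‖ ^ 2 - 2 * ⟪η, u⟫)) - -(s * (‖η‖ ^ 2 - 2 * ⟪η, v⟫))
      = 2 * ⟪η, r • u - s • v⟫ - (r - s) * ‖η‖ ^ 2 := by
    rw [inner_sub_right, real_inner_smul_right, real_inner_smul_right]
    ring
  rw [h]
  refine (abs_sub _ _).trans ?_
  rw [abs_mul, abs_mul, abs_of_nonneg (sq_nonneg ‖η‖), abs_two]
  have := abs_real_inner_le_norm η (r • u - s • v)
  linarith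

lemma norm_dualInt_le (ψ : SchwartzMap (E d) V) (s : ℝ) (u : E d) :
    ‖dualInt ψ s u‖ ≤ ∫ w, ‖ψ w‖ :=
  norm_integral_phase_smul_le ψ _

lemma norm_dualInt_sub_le (ψ : SchwartzMap (E d) V) (s t : ℝ) (u v : E d) :
    ‖dualInt ψ s u - dualInt ψ t v‖
      ≤ 2 * Real.pi * ‖u - v‖ * (∫ w, ‖w‖ * ‖ψ w‖)
        + Real.pi ^ 2 * |s - t| * ∫ w, ‖w‖ ^ 2 * ‖ψ w‖ := by
  refine norm_integral_phase_sub_le ψ (by fun_prop) (by fun_prop) fun w => ?_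
  have h : Real.pi ^ 2 * s * ‖w‖ ^ 2 - 2 * Real.pi * ⟪u, w⟫
      - (Real.pi ^ 2 * t * ‖w‖ ^ 2 - 2 * Real.pi * ⟪v, w⟫)
      = Real.pi ^ 2 * (s - t) * ‖w‖ ^ 2 - 2 * Real.pi * ⟪u - v, w⟫ := by
    rw [inner_sub_left]
    ring
  rw [h]
  refine (abs_sub _ _).trans ?_
  rw [abs_mul, abs_mul, abs_mul, abs_mul, abs_of_nonneg (sq_nonneg ‖w‖), abs_two,
    abs_of_pos Real.pi_pos, abs_of_nonneg (sq_nonneg Real.pi)]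
  have := mul_le_mul_of_nonneg_left (abs_real_inner_le_norm (u - v) w)
    (by positivity : 0 ≤ 2 * Real.pi)
  linarith

lemma norm_pi_div_cpow {r : ℝ} (hr : 0 < r) (d : ℕ) :
    ‖((Real.pi : ℂ) / (r * I)) ^ (d / 2 : ℂ)‖
      = Real.pi ^ (d / 2 : ℝ) * r ^ (-(d / 2 : ℝ)) := by
  have h : (d / 2 : ℂ) = ((d / 2 : ℝ) : ℂ) := by push_cast; rfl
  rw [h, Complex.norm_cpow_real, norm_div, norm_mul, Complex.norm_I, mul_one,
    Complex.norm_real, Complex.norm_real, Real.norm_of_nonneg Real.pi_pos.le,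
    Real.norm_of_nonneg hr.le, Real.div_rpow Real.pi_pos.le hr.le, Real.rpow_neg hr.le,
    div_eq_mul_inv]

lemma le_mul_one_add_rpow_of_le {d : ℕ} (hd : 3 ≤ d) {x a c t : ℝ} (ha : 0 ≤ a) (hc : 0 ≤ c)
    (ht : 0 ≤ t) (h0 : t ≤ 1 → x ≤ a) (h1 : 1 ≤ t → x ≤ c * t ^ (-(d / 2 : ℝ))) :
    x ≤ 2 ^ (3 / 2 : ℝ) * (a + c) * (1 + t) ^ (-(3 / 2) : ℝ) := by
  have h2 : (2 : ℝ) ^ (3 / 2 : ℝ) * 2 ^ (-(3 / 2) : ℝ) = 1 := by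
    rw [← Real.rpow_add two_pos]
    norm_num
  have hp : (0 : ℝ) < 2 ^ (3 / 2 : ℝ) := by positivity
  rcases le_total t 1 with h | h
  · have h3 : (2 : ℝ) ^ (-(3 / 2) : ℝ) ≤ (1 + t) ^ (-(3 / 2) : ℝ) :=
      Real.rpow_le_rpow_of_nonpos (by linarith) (by linarith) (by norm_num)
    calc x ≤ a := h0 h
      _ ≤ a + c := by linarith
      _ = 2 ^ (3 / 2 : ℝ) * (a + c) * 2 ^ (-(3 / 2) : ℝ) := by
        rw [mul_right_comm, h2, one_mul]
      _ ≤ _ := by gcongr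
  · have h3 : (2 * t) ^ (-(3 / 2) : ℝ) ≤ (1 + t) ^ (-(3 / 2) : ℝ) :=
      Real.rpow_le_rpow_of_nonpos (by linarith) (by linarith) (by norm_num)
    have h4 : t ^ (-(d / 2 : ℝ)) ≤ t ^ (-(3 / 2) : ℝ) := by
      refine Real.rpow_le_rpow_of_exponent_le h ?_
      have : (3 : ℝ) ≤ d := by exact_mod_cast hd
      linarith
    rw [Real.mul_rpow (by norm_num) ht] at h3
    have ht0 : 0 ≤ t ^ (-(3 / 2) : ℝ) := by positivity
    calc x ≤ c * t ^ (-(d / 2 : ℝ)) := h1 h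
      _ ≤ c * t ^ (-(3 / 2) : ℝ) := by gcongr
      _ ≤ (a + c) * t ^ (-(3 / 2) : ℝ) := by gcongr; linarith
      _ = 2 ^ (3 / 2 : ℝ) * (a + c) * (2 ^ (-(3 / 2) : ℝ) * t ^ (-(3 / 2) : ℝ)) := by
        rw [show (2 : ℝ) ^ (3 / 2 : ℝ) * (a + c) * (2 ^ (-(3 / 2) : ℝ) * t ^ (-(3 / 2) : ℝ))
          = (2 ^ (3 / 2 : ℝ) * 2 ^ (-(3 / 2) : ℝ)) * ((a + c) * t ^ (-(3 / 2) : ℝ)) by ring,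
          h2, one_mul]
      _ ≤ _ := by gcongr

lemma exists_norm_oscInt_le [CompleteSpace V] (hd : 3 ≤ d) (φ : SchwartzMap (E d) V) :
    ∃ K, 0 ≤ K ∧ ∀ r, 0 ≤ r → ∀ u, ‖oscInt φ r u‖ ≤ K * (1 + r) ^ (-(3 / 2) : ℝ) := by
  refine ⟨2 ^ (3 / 2 : ℝ) * ((∫ η, ‖φ η‖)
    + Real.pi ^ (d / 2 : ℝ) * ∫ w, ‖(𝓕⁻ φ : SchwartzMap (E d) V) w‖), by positivity,
    fun r hr u => le_mul_one_add_rpow_of_le hd (by positivity) (by positivity) hr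
      (fun _ => norm_oscInt_le φ r u) fun h => ?_⟩
  have hr0 : 0 < r := by linarith
  rw [oscInt_eq φ hr0, norm_smul, norm_smul, Complex.norm_exp_ofReal_mul_I, one_mul,
    norm_pi_div_cpow hr0, mul_right_comm]
  gcongr
  exact norm_dualInt_le _ _ _

lemma oscInt_rescaled_eq [CompleteSpace V] (φ : SchwartzMap (E d) V) {t : ℝ} (ht : 0 < t)
    {u : E d} (hu : u ≠ 0) :
    oscInt φ (t / ‖u‖ ^ 2) u = (Real.pi / (t * I)) ^ (d / 2 : ℂ) •
      Complex.exp (t * I) • ((‖u‖ ^ d : ℝ) : ℂ) • dualInt (𝓕⁻ φ) (‖u‖ ^ 2 / t) u := by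
  have hu' : 0 < ‖u‖ := norm_pos_iff.2 hu
  rw [oscInt_eq φ (by positivity), inv_div, div_mul_cancel₀ _ (by positivity)]
  have hz : (Real.pi : ℂ) / (t * I) ≠ 0 := by simp [Real.pi_ne_zero, ht.ne']
  have h1 : (Real.pi : ℂ) / ((t / ‖u‖ ^ 2 : ℝ) * I)
      = ((‖u‖ ^ 2 : ℝ) : ℂ) * (Real.pi / (t * I)) := by
    have : (‖u‖ : ℂ) ≠ 0 := by exact_mod_cast hu'.ne'
    have : (t : ℂ) ≠ 0 := by exact_mod_cast ht.ne'
    push_cast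
    field_simp
  have h2 : ((Real.pi : ℂ) / ((t / ‖u‖ ^ 2 : ℝ) * I)) ^ (d / 2 : ℂ)
      = ((‖u‖ ^ d : ℝ) : ℂ) * (Real.pi / (t * I)) ^ (d / 2 : ℂ) := by
    have hq : ((‖u‖ ^ 2 : ℝ) : ℂ) ≠ 0 := by
      exact_mod_cast (by positivity : ‖u‖ ^ 2 ≠ 0)
    rw [h1, Complex.cpow_def_of_ne_zero (mul_ne_zero hq hz),
      Complex.log_ofReal_mul (by positivity) hz, add_mul, Complex.exp_add,
      ← Complex.cpow_def_of_ne_zero hz, Real.log_pow]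
    congr 1
    rw [show ((((2 : ℕ) : ℝ) * Real.log ‖u‖ : ℝ) : ℂ) * (d / 2 : ℂ)
      = ((d * Real.log ‖u‖ : ℝ) : ℂ) by push_cast; ring, ← Complex.ofReal_exp,
      Real.exp_nat_mul, Real.exp_log hu']
  rw [h2, mul_comm, mul_smul, smul_comm ((‖u‖ ^ d : ℝ) : ℂ)]

lemma abs_norm_sq_sub_norm_sq_le {u v : E d} {M : ℝ} (hu : ‖u‖ ≤ M) (hv : ‖v‖ ≤ M) :
    |‖u‖ ^ 2 - ‖v‖ ^ 2| ≤ 2 * M * ‖u - v‖ := by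
  have hM : 0 ≤ M := (norm_nonneg u).trans hu
  rw [sq_sub_sq, abs_mul, abs_of_nonneg (by positivity)]
  gcongr
  · linarith
  · exact abs_norm_sub_norm_le u v

lemma abs_div_norm_sq_sub_le {c M t : ℝ} (hc : 0 < c) (ht : 0 < t) (ht1 : t ≤ 1) {u v : E d}
    (hu : c ≤ ‖u‖) (huM : ‖u‖ ≤ M) (hv : c ≤ ‖v‖) (hvM : ‖v‖ ≤ M) :
    |t / ‖u‖ ^ 2 - t / ‖v‖ ^ 2| ≤ 2 * M / c ^ 4 * ‖u - v‖ := by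
  have hu0 : 0 < ‖u‖ := hc.trans_le hu
  have hv0 : 0 < ‖v‖ := hc.trans_le hv
  have hM : 0 < M := hu0.trans_le huM
  have hinv : |1 / ‖u‖ ^ 2 - 1 / ‖v‖ ^ 2| ≤ 2 * M / c ^ 4 * ‖u - v‖ := by
    rw [div_sub_div _ _ (by positivity) (by positivity), abs_div, one_mul, mul_one,
      abs_of_nonneg (by positivity : 0 ≤ ‖u‖ ^ 2 * ‖v‖ ^ 2), abs_sub_comm, div_mul_eq_mul_div]
    have h4 : c ^ 4 ≤ ‖u‖ ^ 2 * ‖v‖ ^ 2 := by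
      calc c ^ 4 = c ^ 2 * c ^ 2 := by ring
        _ ≤ _ := by gcongr
    exact div_le_div₀ (by positivity) (abs_norm_sq_sub_norm_sq_le huM hvM) (by positivity) h4
  rw [show t / ‖u‖ ^ 2 - t / ‖v‖ ^ 2 = t * (1 / ‖u‖ ^ 2 - 1 / ‖v‖ ^ 2) by ring, abs_mul,
    abs_of_pos ht]
  exact (mul_le_of_le_one_left (abs_nonneg _) ht1).trans hinv

lemma norm_div_norm_sq_smul_sub_le {c M t : ℝ} (hc : 0 < c) (ht : 0 < t) (ht1 : t ≤ 1)
    {u v : E d} (hu : c ≤ ‖u‖) (huM : ‖u‖ ≤ M) (hv : c ≤ ‖v‖) (hvM : ‖v‖ ≤ M) :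
    ‖(t / ‖u‖ ^ 2) • u - (t / ‖v‖ ^ 2) • v‖
      ≤ (1 / c ^ 2 + M * (2 * M / c ^ 4)) * ‖u - v‖ := by
  have hM : 0 < M := hc.trans_le (hu.trans huM)
  have h1 := abs_div_norm_sq_sub_le hc ht ht1 hu huM hv hvM
  have h3 : t / ‖u‖ ^ 2 ≤ 1 / c ^ 2 := by gcongr
  rw [show (t / ‖u‖ ^ 2) • u - (t / ‖v‖ ^ 2) • v
    = (t / ‖u‖ ^ 2) • (u - v) + (t / ‖u‖ ^ 2 - t / ‖v‖ ^ 2) • v by module]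
  refine (norm_add_le _ _).trans ?_
  rw [norm_smul, norm_smul, add_mul, Real.norm_of_nonneg (by positivity), Real.norm_eq_abs]
  refine add_le_add (mul_le_mul_of_nonneg_right h3 (norm_nonneg _)) ?_
  calc _ ≤ (2 * M / c ^ 4 * ‖u - v‖) * M :=
        mul_le_mul h1 hvM (norm_nonneg _) (by positivity)
    _ = _ := by ring

lemma norm_oscInt_rescaled_sub_le_of_le_one (φ : SchwartzMap (E d) V) {c M t : ℝ} (hc : 0 < c)
    (ht : 0 < t) (ht1 : t ≤ 1) {u v : E d} (hu : c ≤ ‖u‖) (huM : ‖u‖ ≤ M) (hv : c ≤ ‖v‖)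
    (hvM : ‖v‖ ≤ M) :
    ‖oscInt φ (t / ‖u‖ ^ 2) u - oscInt φ (t / ‖v‖ ^ 2) v‖
      ≤ (2 * (1 / c ^ 2 + M * (2 * M / c ^ 4)) * (∫ η, ‖η‖ * ‖φ η‖)
        + 2 * M / c ^ 4 * ∫ η, ‖η‖ ^ 2 * ‖φ η‖) * ‖u - v‖ := by
  have hA₁ : 0 ≤ ∫ η, ‖η‖ * ‖φ η‖ := integral_nonneg fun η => by positivity
  have hA₂ : 0 ≤ ∫ η, ‖η‖ ^ 2 * ‖φ η‖ := integral_nonneg fun η => by positivity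
  refine (norm_oscInt_sub_le φ _ _ u v).trans ?_
  have h5 := mul_le_mul_of_nonneg_right
    (norm_div_norm_sq_smul_sub_le hc ht ht1 hu huM hv hvM) hA₁
  have h6 := mul_le_mul_of_nonneg_right (abs_div_norm_sq_sub_le hc ht ht1 hu huM hv hvM) hA₂
  linarith

lemma norm_oscInt_rescaled_sub_le_of_one_le [CompleteSpace V] (φ : SchwartzMap (E d) V)
    {M t : ℝ} (ht1 : 1 ≤ t) {u v : E d} (hu : u ≠ 0) (huM : ‖u‖ ≤ M) (hv : v ≠ 0)
    (hvM : ‖v‖ ≤ M) :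
    ‖oscInt φ (t / ‖u‖ ^ 2) u - oscInt φ (t / ‖v‖ ^ 2) v‖
      ≤ Real.pi ^ (d / 2 : ℝ) * (M ^ d * (2 * Real.pi *
          (∫ w, ‖w‖ * ‖(𝓕⁻ φ : SchwartzMap (E d) V) w‖)
          + Real.pi ^ 2 * (2 * M) * (∫ w, ‖w‖ ^ 2 * ‖(𝓕⁻ φ : SchwartzMap (E d) V) w‖))
        + d * M ^ (d - 1) * (∫ w, ‖(𝓕⁻ φ : SchwartzMap (E d) V) w‖)) * ‖u - v‖
        * t ^ (-(d / 2 : ℝ)) := by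
  have ht : 0 < t := by linarith
  have hM : 0 ≤ M := (norm_nonneg u).trans huM
  rw [oscInt_rescaled_eq φ ht hu, oscInt_rescaled_eq φ ht hv,
    ← smul_sub, ← smul_sub, norm_smul, norm_smul, Complex.norm_exp_ofReal_mul_I, one_mul,
    norm_pi_div_cpow ht]
  generalize (𝓕⁻ φ : SchwartzMap (E d) V) = ψ
  have hB₀ : 0 ≤ ∫ w, ‖ψ w‖ := by positivity
  have hB₁ : 0 ≤ ∫ w, ‖w‖ * ‖ψ w‖ := by positivity
  have hB₂ : 0 ≤ ∫ w, ‖w‖ ^ 2 * ‖ψ w‖ := by positivity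
  have h1 : |‖u‖ ^ 2 / t - ‖v‖ ^ 2 / t| ≤ 2 * M * ‖u - v‖ := by
    rw [← sub_div, abs_div, abs_of_pos ht]
    exact (div_le_self (abs_nonneg _) ht1).trans (abs_norm_sq_sub_norm_sq_le huM hvM)
  have h3 : |‖u‖ ^ d - ‖v‖ ^ d| ≤ ‖u - v‖ * d * M ^ (d - 1) := by
    refine (abs_pow_sub_pow_le ..).trans ?_
    have := abs_norm_sub_norm_le u v
    gcongr
    simp [huM, hvM]
  have h4 := norm_dualInt_sub_le ψ (‖u‖ ^ 2 / t) (‖v‖ ^ 2 / t) u v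
  have h5 := norm_dualInt_le ψ (‖v‖ ^ 2 / t) v
  generalize dualInt ψ (‖u‖ ^ 2 / t) u = y at *
  generalize dualInt ψ (‖v‖ ^ 2 / t) v = z at *
  generalize (∫ w, ‖ψ w‖) = B₀ at *
  generalize (∫ w, ‖w‖ * ‖ψ w‖) = B₁ at *
  generalize (∫ w, ‖w‖ ^ 2 * ‖ψ w‖) = B₂ at *
  have h2 : ‖((‖u‖ ^ d : ℝ) : ℂ) • y - ((‖v‖ ^ d : ℝ) : ℂ) • z‖
      ≤ M ^ d * (2 * Real.pi * ‖u - v‖ * B₁ + Real.pi ^ 2 * (2 * M * ‖u - v‖) * B₂)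
        + ‖u - v‖ * d * M ^ (d - 1) * B₀ := by
    rw [show ((‖u‖ ^ d : ℝ) : ℂ) • y - ((‖v‖ ^ d : ℝ) : ℂ) • z
      = ((‖u‖ ^ d : ℝ) : ℂ) • (y - z) + ((‖u‖ ^ d - ‖v‖ ^ d : ℝ) : ℂ) • z by
      push_cast; module]
    refine (norm_add_le _ _).trans ?_
    rw [norm_smul, norm_smul, Complex.norm_real, Complex.norm_real,
      Real.norm_of_nonneg (by positivity), Real.norm_eq_abs]
    refine add_le_add (mul_le_mul (pow_le_pow_left₀ (norm_nonneg _) huM d) (h4.trans ?_)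
      (norm_nonneg _) (by positivity)) (mul_le_mul h3 h5 (norm_nonneg _) (by positivity))
    gcongr
  refine (mul_le_mul_of_nonneg_left h2 (by positivity)).trans_eq ?_
  ring

lemma exists_norm_oscInt_rescaled_sub_le [CompleteSpace V] (hd : 3 ≤ d)
    (φ : SchwartzMap (E d) V) {c M : ℝ} (hc : 0 < c) (hM : 0 ≤ M) :
    ∃ K, 0 ≤ K ∧ ∀ t, 0 < t → ∀ u v : E d, c ≤ ‖u‖ → ‖u‖ ≤ M → c ≤ ‖v‖ → ‖v‖ ≤ M →
      ‖oscInt φ (t / ‖u‖ ^ 2) u - oscInt φ (t / ‖v‖ ^ 2) v‖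
        ≤ K * (1 + t) ^ (-(3 / 2) : ℝ) * ‖u - v‖ := by
  obtain ⟨a, ha0, ha⟩ : ∃ a, 0 ≤ a ∧ ∀ t, 0 < t → t ≤ 1 → ∀ u v : E d, c ≤ ‖u‖ → ‖u‖ ≤ M →
      c ≤ ‖v‖ → ‖v‖ ≤ M → ‖oscInt φ (t / ‖u‖ ^ 2) u - oscInt φ (t / ‖v‖ ^ 2) v‖
        ≤ a * ‖u - v‖ :=
    ⟨_, by positivity, fun t ht ht1 u v hu huM hv hvM =>
      norm_oscInt_rescaled_sub_le_of_le_one φ hc ht ht1 hu huM hv hvM⟩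
  obtain ⟨b, hb0, hb⟩ : ∃ b, 0 ≤ b ∧ ∀ t, 1 ≤ t → ∀ u v : E d, u ≠ 0 → ‖u‖ ≤ M →
      v ≠ 0 → ‖v‖ ≤ M → ‖oscInt φ (t / ‖u‖ ^ 2) u - oscInt φ (t / ‖v‖ ^ 2) v‖
        ≤ b * ‖u - v‖ * t ^ (-(d / 2 : ℝ)) :=
    ⟨_, by positivity, fun t ht1 u v hu huM hv hvM =>
      norm_oscInt_rescaled_sub_le_of_one_le φ ht1 hu huM hv hvM⟩
  refine ⟨2 ^ (3 / 2 : ℝ) * (a + b), by positivity, fun t ht u v hu huM hv hvM => ?_⟩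
  refine (le_mul_one_add_rpow_of_le hd (a := a * ‖u - v‖) (c := b * ‖u - v‖) (by positivity)
    (by positivity) ht.le (fun h => ha t ht h u v hu huM hv hvM)
    (fun h => hb t h u v (norm_pos_iff.1 (hc.trans_le hu)) huM
      (norm_pos_iff.1 (hc.trans_le hv)) hvM)).trans_eq ?_
  ring

lemma integrable_one_add_rpow :
    IntegrableOn (fun t : ℝ => (1 + t) ^ (-(3 / 2) : ℝ)) (Ioi 0) := by
  have h := integrable_one_add_norm (E := ℝ) (μ := volume) (r := 3 / 2)
    (by rw [Module.finrank_self]; norm_num)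
  refine h.integrableOn.congr_fun (fun t ht => ?_) measurableSet_Ioi
  simp only [Real.norm_of_nonneg (mem_Ioi.1 ht).le]

lemma integrableOn_oscInt [CompleteSpace V] (hd : 3 ≤ d) (φ : SchwartzMap (E d) V) (u : E d) :
    IntegrableOn (fun r => oscInt φ r u) (Ioi 0) := by
  obtain ⟨K, -, hK⟩ := exists_norm_oscInt_le hd φ
  refine (integrable_one_add_rpow.const_mul K).mono' ?_ ?_
  · exact ((continuous_oscInt φ).comp
      (by fun_prop : Continuous fun r : ℝ => (r, u))).aestronglyMeasurable
  · exact (ae_restrict_mem measurableSet_Ioi).mono fun r hr => hK r (mem_Ioi.1 hr).le u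

lemma exists_norm_integral_oscInt_sub_le [CompleteSpace V] (hd : 3 ≤ d)
    (φ : SchwartzMap (E d) V) {c M : ℝ} (hc : 0 < c) (hM : 0 ≤ M) :
    ∃ K, 0 ≤ K ∧ ∀ u v : E d, c ≤ ‖u‖ → ‖u‖ ≤ M → c ≤ ‖v‖ → ‖v‖ ≤ M →
      ‖(∫ r in Ioi 0, oscInt φ r u) - ∫ r in Ioi 0, oscInt φ r v‖ ≤ K * ‖u - v‖ := by
  obtain ⟨K, hK0, hK⟩ := exists_norm_oscInt_rescaled_sub_le hd φ hc hM
  obtain ⟨B, hB0, hB⟩ := exists_norm_oscInt_le hd φ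
  set J := ∫ t in Ioi (0 : ℝ), (1 + t) ^ (-(3 / 2) : ℝ)
  have hJ : 0 ≤ J := setIntegral_nonneg measurableSet_Ioi fun t ht => by
    have := mem_Ioi.1 ht
    positivity
  have hscale : ∀ u : E d, c ≤ ‖u‖ →
      IntegrableOn (fun t => oscInt φ (t / ‖u‖ ^ 2) u) (Ioi 0) ∧
      ∫ t in Ioi 0, oscInt φ (t / ‖u‖ ^ 2) u = ‖u‖ ^ 2 • ∫ r in Ioi 0, oscInt φ r u := by
    intro u hu
    have hu0 : 0 < ‖u‖ := hc.trans_le hu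
    have hq : 0 < (‖u‖ ^ 2)⁻¹ := by positivity
    constructor
    · have := (integrableOn_Ioi_comp_mul_right_iff (fun r => oscInt φ r u) 0 hq).2
        (by simpa using integrableOn_oscInt hd φ u)
      simpa only [div_eq_mul_inv] using this
    · have := integral_comp_mul_right_Ioi (fun r => oscInt φ r u) 0 hq
      simpa only [div_eq_mul_inv, zero_mul, inv_inv] using this
  refine ⟨(K * J + 2 * M * (B * J)) / c ^ 2, by positivity, fun u v hu huM hv hvM => ?_⟩
  have hu0 : 0 < ‖u‖ := hc.trans_le hu
  obtain ⟨iu, eu⟩ := hscale u hu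
  obtain ⟨iv, ev⟩ := hscale v hv
  set Φu := ∫ r in Ioi 0, oscInt φ r u
  set Φv := ∫ r in Ioi 0, oscInt φ r v
  have h1 : ‖‖u‖ ^ 2 • Φu - ‖v‖ ^ 2 • Φv‖ ≤ K * J * ‖u - v‖ := by
    rw [← eu, ← ev, ← integral_sub iu iv]
    refine (norm_integral_le_of_norm_le ((integrable_one_add_rpow.const_mul K).mul_const ‖u - v‖)
      ((ae_restrict_mem measurableSet_Ioi).mono fun t ht => hK t ht u v hu huM hv hvM)).trans_eq ?_
    rw [integral_mul_const, integral_const_mul]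
  have h2 : ‖Φv‖ ≤ B * J := by
    refine (norm_integral_le_of_norm_le (integrable_one_add_rpow.const_mul B)
      ((ae_restrict_mem measurableSet_Ioi).mono fun t ht => hB t (mem_Ioi.1 ht).le v)).trans_eq ?_
    rw [integral_const_mul]
  have hsq := abs_norm_sq_sub_norm_sq_le huM hvM
  have h3 : ‖u‖ ^ 2 * ‖Φu - Φv‖ ≤ (K * J + 2 * M * (B * J)) * ‖u - v‖ := by
    calc ‖u‖ ^ 2 * ‖Φu - Φv‖ = ‖‖u‖ ^ 2 • (Φu - Φv)‖ := by
          rw [norm_smul, Real.norm_of_nonneg (by positivity)]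
      _ = ‖(‖u‖ ^ 2 • Φu - ‖v‖ ^ 2 • Φv) - (‖u‖ ^ 2 - ‖v‖ ^ 2) • Φv‖ := by
          congr 1
          module
      _ ≤ K * J * ‖u - v‖ + 2 * M * ‖u - v‖ * (B * J) := by
          refine (norm_sub_le _ _).trans (add_le_add h1 ?_)
          rw [norm_smul, Real.norm_eq_abs]
          gcongr
      _ = _ := by ring
  rw [div_mul_eq_mul_div, le_div_iff₀ (by positivity)]
  calc ‖Φu - Φv‖ * c ^ 2 ≤ ‖Φu - Φv‖ * ‖u‖ ^ 2 := by gcongr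
    _ = ‖u‖ ^ 2 * ‖Φu - Φv‖ := mul_comm _ _
    _ ≤ _ := h3

end PhaseIntegrals

section LimitField

variable {d : ℕ}

lemma exists_schwartzMap_eq_gfun (f : SchwartzMap (E d) ℂ) :
    ∃ g : SchwartzMap (E d) (E d), ∀ η, g η = gfun f η := by
  let q : SchwartzMap (E d) ℝ :=
    SchwartzMap.bilinLeftCLM (innerSL ℝ : ℂ →L[ℝ] ℂ →L[ℝ] ℝ) f.hasTemperateGrowth f
  refine ⟨SchwartzMap.bilinLeftCLM (ContinuousLinearMap.lsmul ℝ ℝ : ℝ →L[ℝ] E d →L[ℝ] E d)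
    (ContinuousLinearMap.id ℝ (E d)).hasTemperateGrowth q, fun η => ?_⟩
  rw [SchwartzMap.bilinLeftCLM_apply, SchwartzMap.bilinLeftCLM_apply]
  exact congrArg (· • η) (real_inner_self_eq_norm_sq (f η))

lemma exists_complexification (d : ℕ) :
    ∃ (ι : E d →L[ℝ] (Fin d → ℂ)) (L : (Fin d → ℂ) →L[ℝ] E d),
      ∀ (z : ℂ) (x : E d), L (z • ι x) = z.re • x := by
  refine ⟨ContinuousLinearMap.pi fun i => Complex.ofRealCLM ∘L EuclideanSpace.proj i,
    ((EuclideanSpace.equiv (Fin d) ℝ).symm : (Fin d → ℝ) →L[ℝ] E d) ∘L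
      ContinuousLinearMap.pi fun i => Complex.reCLM ∘L ContinuousLinearMap.proj i, fun z x => ?_⟩
  ext i
  simp

lemma integrable_gfun (f : SchwartzMap (E d) ℂ) : Integrable (gfun f) := by
  obtain ⟨g, hg⟩ := exists_schwartzMap_eq_gfun f
  exact (integrable_congr (.of_forall hg)).1 g.integrable

/-- Re-expression of `F0inner` through the vector-valued oscillatory integral. -/
lemma exists_F0inner_eq (f : SchwartzMap (E d) ℂ) :
    ∃ (φ : SchwartzMap (E d) (Fin d → ℂ)) (L : (Fin d → ℂ) →L[ℝ] E d),
      ∀ r u, F0inner f r u = L (oscInt φ r u) := by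
  obtain ⟨g, hg⟩ := exists_schwartzMap_eq_gfun f
  obtain ⟨ι, L, hL⟩ := exists_complexification d
  refine ⟨SchwartzMap.postcompCLM ι g, L, fun r u => ?_⟩
  rw [oscInt, ← L.integral_comp_comm (integrable_phase_smul _ (by fun_prop)), F0inner]
  refine integral_congr_ae (.of_forall fun η => ?_)
  simp only [SchwartzMap.postcompCLM_apply, hg, hL, Complex.exp_ofReal_mul_I_re, Real.cos_neg]

lemma continuous_F0inner (f : SchwartzMap (E d) ℂ) :
    Continuous fun p : ℝ × E d => F0inner f p.1 p.2 := by
  obtain ⟨φ, L, h⟩ := exists_F0inner_eq f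
  simp only [h]
  exact L.continuous.comp (continuous_oscInt φ)

lemma exists_norm_F0inner_le (hd : 3 ≤ d) (f : SchwartzMap (E d) ℂ) :
    ∃ K, 0 ≤ K ∧ ∀ r, 0 ≤ r → ∀ u, ‖F0inner f r u‖ ≤ K * (1 + r) ^ (-(3 / 2) : ℝ) := by
  obtain ⟨φ, L, h⟩ := exists_F0inner_eq f
  obtain ⟨K, hK0, hK⟩ := exists_norm_oscInt_le hd φ
  refine ⟨‖L‖ * K, by positivity, fun r hr u => ?_⟩
  rw [h, mul_assoc]
  exact L.le_opNorm_of_le (hK r hr u)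

lemma exists_norm_F0inner_sub_le (f : SchwartzMap (E d) ℂ) :
    ∃ D, 0 ≤ D ∧ ∀ r, 0 ≤ r → ∀ u v, ‖F0inner f r u - F0inner f r v‖ ≤ D * r * ‖u - v‖ := by
  obtain ⟨φ, L, h⟩ := exists_F0inner_eq f
  have h0 : 0 ≤ ∫ η, ‖η‖ * ‖φ η‖ := integral_nonneg fun η => by positivity
  refine ⟨‖L‖ * (2 * ∫ η, ‖η‖ * ‖φ η‖), by positivity, fun r hr u v => ?_⟩
  rw [h, h, ← map_sub]
  refine (L.le_opNorm_of_le (norm_oscInt_sub_le φ r r u v)).trans_eq ?_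
  rw [← smul_sub, norm_smul, Real.norm_of_nonneg hr, sub_self, abs_zero, zero_mul, add_zero]
  ring

lemma integrableOn_F0inner (hd : 3 ≤ d) (f : SchwartzMap (E d) ℂ) (u : E d) :
    IntegrableOn (fun r => F0inner f r u) (Ioi 0) := by
  obtain ⟨φ, L, h⟩ := exists_F0inner_eq f
  simp only [h]
  exact L.integrable_comp (integrableOn_oscInt hd φ u)

lemma F0pt_eq (hd : 3 ≤ d) (f : SchwartzMap (E d) ℂ) (u : E d) :
    F0pt f u = (-2 : ℝ) • ∫ r in Ioi 0, F0inner f r u := by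
  rw [← integral_smul]
  exact (intervalIntegral_tendsto_integral_Ioi 0 ((integrableOn_F0inner hd f u).smul (-2 : ℝ))
    tendsto_id).limUnder_eq

lemma exists_norm_F0pt_sub_le (hd : 3 ≤ d) (f : SchwartzMap (E d) ℂ) {c M : ℝ} (hc : 0 < c)
    (hM : 0 ≤ M) :
    ∃ K, 0 ≤ K ∧ ∀ u v : E d, c ≤ ‖u‖ → ‖u‖ ≤ M → c ≤ ‖v‖ → ‖v‖ ≤ M →
      ‖F0pt f u - F0pt f v‖ ≤ K * ‖u - v‖ := by
  obtain ⟨φ, L, h⟩ := exists_F0inner_eq f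
  obtain ⟨K, hK0, hK⟩ := exists_norm_integral_oscInt_sub_le hd φ hc hM
  refine ⟨2 * (‖L‖ * K), by positivity, fun u v hu huM hv hvM => ?_⟩
  rw [F0pt_eq hd, F0pt_eq hd, ← smul_sub, norm_smul]
  simp only [h]
  rw [L.integral_comp_comm (integrableOn_oscInt hd φ u),
    L.integral_comp_comm (integrableOn_oscInt hd φ v), ← map_sub, mul_assoc, mul_assoc]
  simpa using L.le_opNorm_of_le (hK u v hu huM hv hvM)

end LimitField

section MemoryField

variable {d : ℕ}

lemma measurable_intAvg {u : ℝ → E d} (hu : Continuous u) (h t : ℝ) :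
    Measurable fun r => intAvg u (t - h * r) t := by
  have h1 : Continuous fun r => ∫ σ in (t - h * r)..t, u σ := by
    simp only [intervalIntegral.integral_symm t]
    exact ((intervalIntegral.continuous_primitive (fun a b => hu.intervalIntegrable a b) t).comp
      (by fun_prop : Continuous fun r => t - h * r)).neg
  have h2 : Measurable fun r : ℝ => (t - (t - h * r))⁻¹ := by fun_prop
  exact h2.smul h1.measurable

lemma calF_eq (f : SchwartzMap (E d) ℂ) {u : ℝ → E d} (hu : Continuous u) {h t : ℝ}
    (hh : 0 < h) (ht : 0 ≤ t) :
    calF f h u t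
      = (-2 : ℝ) • ∫ r in (0 : ℝ)..(t / h), F0inner f r (intAvg u (t - h * r) t) := by
  have hth : 0 ≤ t / h := by positivity
  have hint : Integrable (Function.uncurry fun (η : E d) (r : ℝ) =>
      Real.cos (r * (‖η‖ ^ 2 - 2 * ⟪η, intAvg u (t - h * r) t⟫)) • gfun f η)
      (volume.prod (volume.restrict (Ioc 0 (t / h)))) := by
    refine ((integrable_gfun f).comp_fst (volume.restrict (Ioc 0 (t / h)))).mono ?_
      (.of_forall fun p => ?_)
    · have hm := measurable_intAvg hu h t
      have : Measurable fun p : E d × ℝ =>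
          Real.cos (p.2 * (‖p.1‖ ^ 2 - 2 * ⟪p.1, intAvg u (t - h * p.2) t⟫)) := by
        have h1 : Measurable fun p : E d × ℝ => ⟪p.1, intAvg u (t - h * p.2) t⟫ :=
          measurable_fst.inner (hm.comp measurable_snd)
        fun_prop
      exact this.aestronglyMeasurable.smul
        ((integrable_gfun f).comp_fst (volume.restrict (Ioc 0 (t / h)))).aestronglyMeasurable
    · rw [Function.uncurry, norm_smul]
      exact mul_le_of_le_one_left (norm_nonneg _) (Real.abs_cos_le_one _)
  simp only [calF, F0inner, intervalIntegral.integral_of_le hth, ← integral_smul_const]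
  rw [integral_integral_swap hint]

lemma calF_congr (f : SchwartzMap (E d) ℂ) {u v : ℝ → E d} (huv : EqOn u v (Ici 0)) {h t : ℝ}
    (hh : 0 < h) (ht : 0 ≤ t) : calF f h u t = calF f h v t := by
  have hth : 0 ≤ t / h := by positivity
  have havg : ∀ r ∈ uIcc 0 (t / h), intAvg u (t - h * r) t = intAvg v (t - h * r) t := by
    intro r hr
    rw [uIcc_of_le hth, mem_Icc, le_div_iff₀ hh] at hr
    have h0 : 0 ≤ h * r := mul_nonneg hh.le hr.1
    rw [intAvg, intAvg, intervalIntegral.integral_congr (huv.mono fun σ hσ => ?_)]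
    rw [uIcc_of_le (by linarith)] at hσ
    exact mem_Ici.2 (by linarith [hσ.1])
  refine congrArg ((-2 : ℝ) • ·) (integral_congr_ae (.of_forall fun η =>
    congrArg (· • gfun f η) (intervalIntegral.integral_congr fun r hr => ?_)))
  simp only [havg r hr]

lemma norm_intAvg_sub_le {u : ℝ → E d} (hu : Continuous u) {C : ℝ}
    (hC : ∀ s, 0 ≤ s → ∀ t, 0 ≤ t → ‖u t - u s‖ ≤ C * |t - s|) {a b : ℝ} (ha : 0 ≤ a)
    (hab : a < b) : ‖intAvg u a b - u b‖ ≤ C * (b - a) := by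
  have hba : 0 < b - a := sub_pos.2 hab
  have hC0 : 0 ≤ C := by
    have := (norm_nonneg _).trans (hC a ha b (ha.trans hab.le))
    rw [abs_of_pos hba] at this
    exact nonneg_of_mul_nonneg_left this hba
  have h1 : intAvg u a b - u b = (b - a)⁻¹ • ∫ σ in a..b, (u σ - u b) := by
    rw [intervalIntegral.integral_sub (hu.intervalIntegrable a b) (by simp),
      intervalIntegral.integral_const, smul_sub, inv_smul_smul₀ hba.ne', intAvg]
  have h2 : ‖∫ σ in a..b, (u σ - u b)‖ ≤ C * (b - a) * |b - a| := by
    refine intervalIntegral.norm_integral_le_of_norm_le_const fun σ hσ => ?_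
    rw [uIoc_of_le hab.le] at hσ
    refine (hC b (ha.trans hab.le) σ (ha.trans hσ.1.le)).trans ?_
    gcongr
    rw [abs_le]
    constructor <;> linarith [hσ.1, hσ.2]
  rw [h1, norm_smul, Real.norm_of_nonneg (by positivity), inv_mul_le_iff₀ hba]
  rw [abs_of_pos hba] at h2
  linarith

lemma integral_tail_nonneg {a : ℝ} (ha : 0 ≤ a) :
    0 ≤ ∫ r in Ioi a, (1 + r) ^ (-(3 / 2) : ℝ) :=
  setIntegral_nonneg measurableSet_Ioi fun r hr => by
    have : 0 < r := ha.trans_lt hr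
    positivity

lemma norm_setIntegral_le_tail {G : ℝ → E d} {K a : ℝ} (hK : 0 ≤ K) (ha : 0 ≤ a)
    (hG : ∀ r, 0 ≤ r → ‖G r‖ ≤ K * (1 + r) ^ (-(3 / 2) : ℝ)) {s : Set ℝ}
    (hs : MeasurableSet s) (hsa : s ⊆ Ioi a) :
    ‖∫ r in s, G r‖ ≤ K * ∫ r in Ioi a, (1 + r) ^ (-(3 / 2) : ℝ) := by
  have hi : IntegrableOn (fun r : ℝ => K * (1 + r) ^ (-(3 / 2) : ℝ)) (Ioi a) :=
    (integrable_one_add_rpow.mono_set (Ioi_subset_Ioi ha)).const_mul K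
  rw [← integral_const_mul]
  refine (norm_integral_le_of_norm_le (hi.mono_set hsa) ((ae_restrict_mem hs).mono
    fun r hr => hG r (ha.trans (le_of_lt (hsa hr))))).trans (setIntegral_mono_set hi
    ((ae_restrict_mem measurableSet_Ioi).mono fun r hr => ?_) hsa.eventuallyLE)
  have : 0 < r := ha.trans_lt hr
  simp only [Pi.zero_apply]
  positivity

lemma tendsto_integral_tail :
    Tendsto (fun R : ℝ => ∫ r in Ioi R, (1 + r) ^ (-(3 / 2) : ℝ)) atTop (𝓝 0) := by
  have h := (intervalIntegral_tendsto_integral_Ioi 0 integrable_one_add_rpow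
    tendsto_id).const_sub (∫ r in Ioi (0 : ℝ), (1 + r) ^ (-(3 / 2) : ℝ))
  rw [sub_self] at h
  refine h.congr' ((eventually_ge_atTop 0).mono fun R hR => ?_)
  rw [id, ← intervalIntegral.integral_interval_add_Ioi integrable_one_add_rpow
    (integrable_one_add_rpow.mono_set (Ioi_subset_Ioi hR)), add_sub_cancel_left]

/-- The memory field is close to its Markovian limit after the initial layer `[0, hR]`. -/
lemma norm_calF_sub_F0pt_le (hd : 3 ≤ d) (f : SchwartzMap (E d) ℂ) {K D C : ℝ} (hK0 : 0 ≤ K)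
    (hK : ∀ r, 0 ≤ r → ∀ u, ‖F0inner f r u‖ ≤ K * (1 + r) ^ (-(3 / 2) : ℝ)) (hD0 : 0 ≤ D)
    (hD : ∀ r, 0 ≤ r → ∀ u v, ‖F0inner f r u - F0inner f r v‖ ≤ D * r * ‖u - v‖)
    (hC0 : 0 ≤ C) {u : ℝ → E d} (hu : Continuous u)
    (hC : ∀ s, 0 ≤ s → ∀ t, 0 ≤ t → ‖u t - u s‖ ≤ C * |t - s|) {h t R : ℝ} (hh : 0 < h)
    (hR : 0 ≤ R) (ht : h * R ≤ t) :
    ‖calF f h u t - F0pt f (u t)‖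
      ≤ 2 * (D * C * h * R ^ 3 + 2 * (K * ∫ r in Ioi R, (1 + r) ^ (-(3 / 2) : ℝ))) := by
  have ht0 : 0 ≤ t := (by positivity : 0 ≤ h * R).trans ht
  have hRt : R ≤ t / h := by rwa [le_div_iff₀ hh, mul_comm]
  set G := fun r => F0inner f r (intAvg u (t - h * r) t) with hGdef
  have hG : ∀ r, 0 ≤ r → ‖G r‖ ≤ K * (1 + r) ^ (-(3 / 2) : ℝ) := fun r hr => hK r hr _
  have hGint : IntegrableOn G (Ioi 0) := by
    refine (integrable_one_add_rpow.const_mul K).mono' ?_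
      ((ae_restrict_mem measurableSet_Ioi).mono fun r hr => hG r (le_of_lt hr))
    exact ((continuous_F0inner f).measurable.comp
      (measurable_id.prodMk (measurable_intAvg hu h t))).aestronglyMeasurable
  have hFint := integrableOn_F0inner hd f (u t)
  have hi : ∀ {F : ℝ → E d}, IntegrableOn F (Ioi 0) → ∀ a b : ℝ, 0 ≤ a → a ≤ b →
      IntervalIntegrable F volume a b := fun hF a b ha hab =>
    (intervalIntegrable_iff_integrableOn_Ioc_of_le hab).2
      (hF.mono_set (Ioc_subset_Ioi_self.trans (Ioi_subset_Ioi ha)))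
  have e1 : calF f h u t - F0pt f (u t) = (-2 : ℝ) •
      ((∫ r in (0 : ℝ)..R, (G r - F0inner f r (u t))) + ((∫ r in R..(t / h), G r)
        - ∫ r in Ioi R, F0inner f r (u t))) := by
    rw [calF_eq f hu hh ht0, F0pt_eq hd,
      intervalIntegral.integral_sub (hi hGint 0 R le_rfl hR) (hi hFint 0 R le_rfl hR),
      ← intervalIntegral.integral_add_adjacent_intervals (hi hGint 0 R le_rfl hR)
        (hi hGint R (t / h) hR hRt),
      ← intervalIntegral.integral_interval_add_Ioi hFint (hFint.mono_set (Ioi_subset_Ioi hR))]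
    module
  have h1 : ‖∫ r in (0 : ℝ)..R, (G r - F0inner f r (u t))‖ ≤ D * R * (C * (h * R)) * |R - 0| := by
    refine intervalIntegral.norm_integral_le_of_norm_le_const fun r hr => ?_
    rw [uIoc_of_le hR] at hr
    have h0 : 0 < h * r := mul_pos hh hr.1
    have h2 : h * r ≤ h * R := by gcongr; exact hr.2
    have h3 := norm_intAvg_sub_le hu hC (a := t - h * r) (b := t) (by linarith) (by linarith)
    rw [sub_sub_cancel] at h3
    refine (hD r hr.1.le _ _).trans ?_
    have := hr.2
    gcongr
    exact h3.trans (by gcongr)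
  have h2 : ‖∫ r in R..(t / h), G r‖ ≤ K * ∫ r in Ioi R, (1 + r) ^ (-(3 / 2) : ℝ) := by
    rw [intervalIntegral.integral_of_le hRt]
    exact norm_setIntegral_le_tail hK0 hR hG measurableSet_Ioc Ioc_subset_Ioi_self
  have h3 : ‖∫ r in Ioi R, F0inner f r (u t)‖
      ≤ K * ∫ r in Ioi R, (1 + r) ^ (-(3 / 2) : ℝ) :=
    norm_setIntegral_le_tail hK0 hR (fun r hr => hK r hr _) measurableSet_Ioi subset_rfl
  rw [e1, norm_smul, Real.norm_eq_abs, abs_neg, abs_two]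
  refine mul_le_mul_of_nonneg_left ?_ zero_le_two
  rw [sub_zero, abs_of_nonneg hR] at h1
  refine (norm_add_le _ _).trans ?_
  have h4 := norm_sub_le (∫ r in R..(t / h), G r) (∫ r in Ioi R, F0inner f r (u t))
  nlinarith

end MemoryField

section Gronwall

variable {V : Type*} [NormedAddCommGroup V] [NormedSpace ℝ V]

/-- If `x` solves `y' = v y` up to an error `η` after an initial layer `[0, a]` on which it stays
`δ`-close to an exact solution `y`, it stays `ρ`-close to `y`; `v` need only be Lipschitz on a
set containing the `ρ`-tube around `y`. -/
lemma norm_sub_lt_of_approx_trajectory {v : V → V} {s : Set V} {L : NNReal} (hL : 0 < L)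
    (hv : LipschitzOnWith L v s) {x y x' : ℝ → V} {T a δ η ρ : ℝ} (ha : 0 ≤ a) (hδ0 : 0 ≤ δ)
    (hη0 : 0 ≤ η) (hxc : ContinuousOn x (Icc 0 T)) (hyc : ContinuousOn y (Icc 0 T))
    (hx : ∀ t ∈ Ico 0 T, HasDerivWithinAt x (x' t) (Ici t) t)
    (hy : ∀ t ∈ Ico 0 T, HasDerivWithinAt y (v (y t)) (Ici t) t)
    (hs : ∀ t ∈ Icc 0 T, Metric.ball (y t) ρ ⊆ s)
    (hlayer : ∀ t ∈ Icc 0 T, t ≤ a → ‖x t - y t‖ ≤ δ)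
    (herr : ∀ t ∈ Ico 0 T, a ≤ t → ‖x' t - v (x t)‖ ≤ η) (hδρ : δ < ρ)
    (hρ : (δ + η / L) * Real.exp (L * T) < ρ) :
    ∀ t ∈ Icc 0 T, ‖x t - y t‖ < ρ := by
  by_contra! hbad
  have hρ0 : 0 < ρ := hδ0.trans_lt hδρ
  set B := Icc 0 T ∩ {t | ρ ≤ ‖x t - y t‖}
  have hB : IsCompact B := by
    refine isCompact_Icc.of_isClosed_subset ?_ inter_subset_left
    exact ContinuousOn.preimage_isClosed_of_isClosed (hxc.sub hyc).norm isClosed_Icc isClosed_Ici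
  obtain ⟨t, ⟨ht, htρ⟩, hmin⟩ := hB.exists_isLeast hbad
  have hat : a < t := by
    by_contra! hta
    exact ((hlayer t ht hta).trans_lt hδρ).not_ge htρ
  have hsub : Icc a t ⊆ Icc 0 T := Icc_subset_Icc ha ht.2
  have hsub' : Ico a t ⊆ Ico 0 T := Ico_subset_Ico ha ht.2
  have hlt : ∀ τ ∈ Ico a t, ‖x τ - y τ‖ < ρ := by
    intro τ hτ
    by_contra! h
    exact (hmin ⟨hsub (Ico_subset_Icc_self hτ), h⟩).not_gt hτ.2
  have key := dist_le_of_approx_trajectories_ODE_of_mem (v := fun _ => v) (s := fun _ => s)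
    (K := L) (f := x) (g := y) (f' := x') (g' := fun t => v (y t)) (a := a) (b := t)
    (εf := η) (εg := 0) (δ := δ) (fun _ _ => hv) (hxc.mono hsub) (fun τ hτ => hx τ (hsub' hτ))
    (fun τ hτ => by rw [dist_eq_norm]; exact herr τ (hsub' hτ) hτ.1)
    (fun τ hτ => hs τ (hsub (Ico_subset_Icc_self hτ))
      (by rw [Metric.mem_ball, dist_eq_norm]; exact hlt τ hτ))
    (hyc.mono hsub) (fun τ hτ => hy τ (hsub' hτ)) (fun τ hτ => by simp)
    (fun τ hτ => hs τ (hsub (Ico_subset_Icc_self hτ)) (Metric.mem_ball_self hρ0))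
    (by rw [dist_eq_norm]; exact hlayer a (hsub (left_mem_Icc.2 hat.le)) le_rfl)
    t (right_mem_Icc.2 hat.le)
  have hL' : (0 : ℝ) < L := hL
  rw [dist_eq_norm, gronwallBound_of_K_ne_0 hL'.ne', add_zero] at key
  have hexp : Real.exp (L * (t - a)) ≤ Real.exp (L * T) := by
    gcongr
    linarith [ht.2]
  have hηL : 0 ≤ η / L := by positivity
  refine htρ.not_gt (key.trans_lt (lt_of_le_of_lt ?_ hρ))
  rw [add_mul]
  exact add_le_add (mul_le_mul_of_nonneg_left hexp hδ0)
    (mul_le_mul_of_nonneg_left (by linarith) hηL)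

end Gronwall

section Convergence

variable {d : ℕ}

lemma continuous_comp_max_zero {x : ℝ → E d} (hx : ContinuousOn x (Ici 0)) :
    Continuous fun t => x (max t 0) :=
  hx.comp_continuous (by fun_prop) fun t => le_max_right t 0

lemma norm_sub_le_of_hasDerivWithinAt_Ici {x x' : ℝ → E d} {C : ℝ}
    (hx : ∀ t ∈ Ici (0 : ℝ), HasDerivWithinAt x (x' t) (Ici 0) t)
    (hC : ∀ t ∈ Ici (0 : ℝ), ‖x' t‖ ≤ C) (s : ℝ) (hs : 0 ≤ s) (t : ℝ) (ht : 0 ≤ t) :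
    ‖x t - x s‖ ≤ C * |t - s| := by
  have := (convex_Ici (0 : ℝ)).norm_image_sub_le_of_norm_hasDerivWithin_le hx hC hs ht
  rwa [Real.norm_eq_abs] at this

lemma norm_calF_le (f : SchwartzMap (E d) ℂ) {K : ℝ} (hK0 : 0 ≤ K)
    (hK : ∀ r, 0 ≤ r → ∀ u, ‖F0inner f r u‖ ≤ K * (1 + r) ^ (-(3 / 2) : ℝ)) {u : ℝ → E d}
    (hu : Continuous u) {h t : ℝ} (hh : 0 < h) (ht : 0 ≤ t) :
    ‖calF f h u t‖ ≤ 2 * (K * ∫ r in Ioi (0 : ℝ), (1 + r) ^ (-(3 / 2) : ℝ)) := by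
  rw [calF_eq f hu hh ht, norm_smul, Real.norm_eq_abs, abs_neg, abs_two,
    intervalIntegral.integral_of_le (by positivity)]
  exact mul_le_mul_of_nonneg_left (norm_setIntegral_le_tail hK0 le_rfl (fun r hr => hK r hr _)
    measurableSet_Ioc Ioc_subset_Ioi_self) zero_le_two

lemma norm_F0pt_le (hd : 3 ≤ d) (f : SchwartzMap (E d) ℂ) {K : ℝ} (hK0 : 0 ≤ K)
    (hK : ∀ r, 0 ≤ r → ∀ u, ‖F0inner f r u‖ ≤ K * (1 + r) ^ (-(3 / 2) : ℝ)) (u : E d) :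
    ‖F0pt f u‖ ≤ 2 * (K * ∫ r in Ioi (0 : ℝ), (1 + r) ^ (-(3 / 2) : ℝ)) := by
  rw [F0pt_eq hd, norm_smul, Real.norm_eq_abs, abs_neg, abs_two]
  exact mul_le_mul_of_nonneg_left (norm_setIntegral_le_tail hK0 le_rfl (fun r hr => hK r hr _)
    measurableSet_Ioi subset_rfl) zero_le_two

/-- `F^(0)` is Lipschitz on a tube around a compact trajectory avoiding the origin. -/
lemma exists_tube_lipschitzOnWith_F0pt (hd : 3 ≤ d) (f : SchwartzMap (E d) ℂ) {T : ℝ}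
    (hT : 0 ≤ T) {y : ℝ → E d} (hyc : ContinuousOn y (Icc 0 T)) (hy : ∀ t ∈ Icc 0 T, y t ≠ 0) :
    ∃ (c : ℝ) (L : NNReal) (s : Set (E d)), 0 < c ∧ 0 < L ∧ LipschitzOnWith L (F0pt f) s ∧
      ∀ t ∈ Icc 0 T, Metric.ball (y t) c ⊆ s := by
  have hne : (Icc 0 T).Nonempty := nonempty_Icc.2 hT
  obtain ⟨a, ha, hmin⟩ := isCompact_Icc.exists_isMinOn hne hyc.norm
  obtain ⟨b, hb, hmax⟩ := isCompact_Icc.exists_isMaxOn hne hyc.norm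
  have hc : 0 < ‖y a‖ / 2 := half_pos (norm_pos_iff.2 (hy a ha))
  obtain ⟨K, hK0, hK⟩ := exists_norm_F0pt_sub_le hd f hc (M := ‖y b‖ + ‖y a‖ / 2) (by positivity)
  refine ⟨‖y a‖ / 2, K.toNNReal + 1, {u | ‖y a‖ / 2 ≤ ‖u‖ ∧ ‖u‖ ≤ ‖y b‖ + ‖y a‖ / 2}, hc,
    by positivity, LipschitzOnWith.of_dist_le_mul fun u hu v hv => ?_, fun t ht u hu => ?_⟩
  · rw [dist_eq_norm, dist_eq_norm, NNReal.coe_add, Real.coe_toNNReal _ hK0]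
    refine (hK u v hu.1 hu.2 hv.1 hv.2).trans ?_
    gcongr
    exact le_add_of_nonneg_right zero_le_one
  · rw [mem_ball_iff_norm] at hu
    have h1 : ‖y a‖ ≤ ‖y t‖ := hmin ht
    have h2 : ‖y t‖ ≤ ‖y b‖ := hmax ht
    have h3 := abs_le.1 (abs_norm_sub_norm_le u (y t))
    constructor <;> linarith [h3.1, h3.2]

end Convergence

/-- for `d ≥ 3`, `f` Schwartz, `ξ₀ ≠ 0`, if `ξ^(0)` is the (maximal, nonvanishing)
solution of `(d/dt)ξ^(0) = F^(0)(ξ^(0))`, `ξ^(0)(0) = ξ₀`, and `T ∈ (0, T_max)` (i.e. `ξ^(0)`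
solves the limit equation on `[0,T]`), then the solutions `ξ^(h)` of
`(d/dt)ξ^(h) = 𝓕^(h)(ξ^(h))`, `ξ^(h)(0) = ξ₀`, converge uniformly on `[0,T]` to `ξ^(0)` as
`h → 0`. -/
theorem statement17 (d : ℕ) (hd : 3 ≤ d) (f : SchwartzMap (E d) ℂ) (ξ₀ : E d) (hξ₀ : ξ₀ ≠ 0)
    (T : ℝ) (hT : 0 < T) (ξ₀fun : ℝ → E d) (hinit0 : ξ₀fun 0 = ξ₀)
    (hsol0 : ∀ t ∈ Set.Icc (0 : ℝ) T,
      ξ₀fun t ≠ 0 ∧ HasDerivWithinAt ξ₀fun (F0pt f (ξ₀fun t)) (Set.Icc (0 : ℝ) T) t) :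
    ∀ ε : ℝ, 0 < ε → ∃ h₀ : ℝ, 0 < h₀ ∧
      ∀ h : ℝ, 0 < h → h ≤ h₀ →
        ∀ ξ : ℝ → E d, ξ 0 = ξ₀ →
          (∀ t ∈ Set.Ici (0 : ℝ), HasDerivWithinAt ξ (calF f h ξ t) (Set.Ici (0 : ℝ)) t) →
          ∀ t ∈ Set.Icc (0 : ℝ) T, ‖ξ t - ξ₀fun t‖ ≤ ε := by
  intro ε hε
  obtain ⟨K, hK0, hK⟩ := exists_norm_F0inner_le hd f
  obtain ⟨D, hD0, hD⟩ := exists_norm_F0inner_sub_le f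
  have hyc : ContinuousOn ξ₀fun (Icc 0 T) := fun t ht => (hsol0 t ht).2.continuousWithinAt
  obtain ⟨c, L, s, hc, hL, hLip, hs⟩ :=
    exists_tube_lipschitzOnWith_F0pt hd f hT.le hyc fun t ht => (hsol0 t ht).1
  set C := 2 * (K * ∫ r in Ioi (0 : ℝ), (1 + r) ^ (-(3 / 2) : ℝ))
  have hC0 : 0 ≤ C := by
    have := integral_tail_nonneg le_rfl
    positivity
  set ρ := min ε c
  have hρ0 : 0 < ρ := lt_min hε hc
  set Λ := Real.exp (L * T)
  have hΛ1 : 1 ≤ Λ := Real.one_le_exp (by positivity)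
  set δ := ρ / (4 * Λ)
  have hδ0 : 0 < δ := by positivity
  set η := L * δ
  have hη0 : 0 < η := by positivity
  have hδΛ : δ * Λ = ρ / 4 := by
    simp only [δ]
    field_simp
  obtain ⟨R, hR0, hR⟩ : ∃ R : ℝ, 0 ≤ R ∧
      4 * K * ∫ r in Ioi R, (1 + r) ^ (-(3 / 2) : ℝ) < η / 2 := by
    have h := tendsto_integral_tail.const_mul (4 * K)
    rw [mul_zero] at h
    exact ((eventually_ge_atTop 0).and (h.eventually_lt_const (by positivity))).exists
  refine ⟨min (η / 2 / (2 * D * C * R ^ 3 + 1)) (δ / (2 * C * R + 1)), by positivity,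
    fun h hh hh₀ ξ hξinit hξ t ht => ?_⟩
  have hh₁ : h * (2 * D * C * R ^ 3 + 1) ≤ η / 2 :=
    (le_div_iff₀ (by positivity)).1 (hh₀.trans (min_le_left _ _))
  have hh₂ : h * (2 * C * R + 1) ≤ δ :=
    (le_div_iff₀ (by positivity)).1 (hh₀.trans (min_le_right _ _))
  set u : ℝ → E d := fun t => ξ (max t 0)
  have huξ : EqOn u ξ (Ici 0) := fun t ht => congrArg ξ (max_eq_left ht)
  have hu : Continuous u :=
    continuous_comp_max_zero fun t ht => (hξ t ht).continuousWithinAt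
  have hu' : ∀ t ∈ Ici (0 : ℝ), HasDerivWithinAt u (calF f h u t) (Ici 0) t := fun t ht => by
    rw [calF_congr f huξ hh ht]
    exact (hξ t ht).congr huξ (huξ ht)
  have huC := norm_sub_le_of_hasDerivWithinAt_Ici hu' fun t ht => norm_calF_le f hK0 hK hu hh ht
  have hlayer : ∀ t ∈ Icc 0 T, t ≤ h * R → ‖u t - ξ₀fun t‖ ≤ δ := by
    intro t ht htR
    have h1 := huC 0 le_rfl t ht.1
    have h2 := (convex_Icc 0 T).norm_image_sub_le_of_norm_hasDerivWithin_le
      (fun t ht => (hsol0 t ht).2) (fun t _ => norm_F0pt_le hd f hK0 hK _)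
      (left_mem_Icc.2 hT.le) ht
    rw [huξ self_mem_Ici, hξinit, sub_zero, abs_of_nonneg ht.1] at h1
    rw [hinit0, sub_zero, Real.norm_of_nonneg ht.1] at h2
    calc ‖u t - ξ₀fun t‖ = ‖(u t - ξ₀) - (ξ₀fun t - ξ₀)‖ := by rw [sub_sub_sub_cancel_right]
      _ ≤ C * t + C * t := (norm_sub_le _ _).trans (add_le_add h1 h2)
      _ ≤ C * (h * R) + C * (h * R) := by gcongr
      _ ≤ h * (2 * C * R + 1) := by linarith
      _ ≤ δ := hh₂
  have herr : ∀ t ∈ Ico 0 T, h * R ≤ t → ‖calF f h u t - F0pt f (u t)‖ ≤ η := by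
    intro t _ hRt
    refine (norm_calF_sub_F0pt_le hd f hK0 hK hD0 hD hC0 hu huC hh hR0 hRt).trans ?_
    linarith
  have hclose := norm_sub_lt_of_approx_trajectory hL hLip (by positivity) hδ0.le hη0.le
    hu.continuousOn hyc (fun t ht => (hu' t ht.1).mono (Ici_subset_Ici.2 ht.1))
    (fun t ht => (hsol0 t (Ico_subset_Icc_self ht)).2.mono_of_mem_nhdsWithin
      (mem_of_superset (Icc_mem_nhdsGE ht.2) (Icc_subset_Icc_left ht.1)))
    (fun t ht => (Metric.ball_subset_ball (min_le_right _ _)).trans (hs t ht)) hlayer herr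
    (by nlinarith) (by
      have hηL : η / L = δ := mul_div_cancel_left₀ δ (NNReal.coe_pos.2 hL).ne'
      rw [hηL, add_mul, hδΛ]
      linarith) t ht
  rw [huξ ht.1] at hclose
  exact hclose.le.trans (min_le_left _ _)
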